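/- (Mixed-source formula, Remark 3.1, eq. (3.28)) For each n ≥ 1 let Ω_n be a measurable space, let P_{1,n}, P_{2,n}, Q_{1,n}, Q_{2,n} be probability measures on Ω_n, let α_1, α_2 > 0 with α_1 + α_2 = 1 and β_1, β_2 > 0 with β_1 + β_2 = 1, and define the mixed null hypothesis P_n = α_1 P_{1,n} + α_2 P_{2,n} and the mixed alternative hypothesis Q_n = β_1 Q_{1,n} + β_2 Q_{2,n}. Then for every r > 0, B_e(r | P ‖ Q) = min over i, j ∈ {1,2} of B_e(r | P_i ‖ Q_j), where B_e(r | P' ‖ Q') denotes the optimal error exponent of the hypothesis testing problem with null hypothesis {P'_n} and alternative hypothesis {Q'_n}. -/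

import Mathlib

open MeasureTheory Filter
open scoped ENNReal NNReal

/-- The exponent `-(1/n) log p` of a nonneg extended real `p`, valued in `EReal`,
with the conventions `-log 0 = +∞` and `-log ∞ = -∞`. -/
noncomputable def expRate (n : ℕ) (p : ℝ≥0∞) : EReal :=
  (((n : ℝ)⁻¹ : ℝ) : EReal) * (-(ENNReal.log p))

/-- The likelihood ratio `dμ/dν`, defined to be `+∞` on the part of the space where
`μ` is singular with respect to `ν` (μ-a.e.). -/
noncomputable def lratio {Ω : Type*} [MeasurableSpace Ω] (μ ν : Measure Ω) (x : Ω) : ℝ≥0∞ :=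
  μ.rnDeriv (μ + ν) x / ν.rnDeriv (μ + ν) x

section Setup

variable {Ω : ℕ → Type*} [∀ n, MeasurableSpace (Ω n)]

/-- `η(R) = liminf_n -(1/n) log P_n{ (1/n) log dP_n/dQ_n ≤ R }`. -/
noncomputable def eta (P Q : ∀ n, Measure (Ω n)) (R : ℝ) : EReal :=
  Filter.atTop.liminf fun n =>
    expRate n ((P n) {x | lratio (P n) (Q n) x ≤ ENNReal.ofReal (Real.exp (n * R))})

/-- `E` is `r`-achievable: there are measurable acceptance regions `A n` with
`liminf -(1/n) log μ_n ≥ r` and `liminf -(1/n) log λ_n ≥ E`. -/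
def rAchievable (P Q : ∀ n, Measure (Ω n)) (r E : ℝ) : Prop :=
  ∃ A : ∀ n, Set (Ω n), (∀ n, MeasurableSet (A n)) ∧
    (r : EReal) ≤ Filter.atTop.liminf (fun n => expRate n ((P n) (A n)ᶜ)) ∧
    (E : EReal) ≤ Filter.atTop.liminf (fun n => expRate n ((Q n) (A n)))

/-- The optimal error exponent `B_e(r)`: the supremum of all `r`-achievable `E`. -/
noncomputable def Be (P Q : ∀ n, Measure (Ω n)) (r : ℝ) : EReal :=
  sSup {x : EReal | ∃ E : ℝ, rAchievable P Q r E ∧ x = (E : EReal)}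

end Setup

lemma le_expRate_iff (n : ℕ) (hn : 0 < n) (b : ℝ) (p : ℝ≥0∞) :
    (b : EReal) ≤ expRate n p ↔ p ≤ ENNReal.ofReal (Real.exp (-(n * b))) := by
  have hn' : (0 : ℝ) < n := by exact_mod_cast hn
  unfold expRate
  rcases eq_or_ne p 0 with rfl | h0
  · simp only [ENNReal.log_zero, EReal.neg_bot, zero_le, iff_true]
    rw [EReal.coe_mul_top_of_pos (inv_pos.mpr hn')]
    exact le_top
  rcases eq_or_ne p ⊤ with rfl | ht
  · simp only [ENNReal.log_top, EReal.neg_top, top_le_iff, ENNReal.ofReal_ne_top, iff_false]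
    rw [EReal.coe_mul_bot_of_pos (inv_pos.mpr hn')]
    simp
  · have hp : 0 < p.toReal := ENNReal.toReal_pos h0 ht
    rw [ENNReal.log_pos_real h0 ht, ← EReal.coe_neg, ← EReal.coe_mul, EReal.coe_le_coe_iff,
      ENNReal.le_ofReal_iff_toReal_le ht (Real.exp_pos _).le, ← Real.log_le_iff_le_exp hp,
      le_inv_mul_iff₀ hn']
    constructor <;> intro h <;> linarith

lemma le_liminf_expRate_iff (p : ℕ → ℝ≥0∞) (c : ℝ) :
    (c : EReal) ≤ Filter.atTop.liminf (fun n => expRate n (p n)) ↔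
      ∀ c' < c, ∀ᶠ n : ℕ in atTop, p n ≤ ENNReal.ofReal (Real.exp (-(n * c'))) := by
  rw [Filter.le_liminf_iff]
  constructor
  · intro h c' hc'
    filter_upwards [h c' (by exact_mod_cast hc'), eventually_gt_atTop 0] with n hn h0
    exact (le_expRate_iff n h0 c' _).1 hn.le
  · intro h y hy
    obtain ⟨q, hq1, hq2⟩ := EReal.lt_iff_exists_real_btwn.1 hy
    filter_upwards [h q (by exact_mod_cast hq2), eventually_gt_atTop 0] with n hn h0
    exact lt_of_lt_of_le hq1 ((le_expRate_iff n h0 q _).2 hn)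

lemma rate_combine (p a b : ℕ → ℝ≥0∞) (K : ℝ) (hK : 0 ≤ K) (c : ℝ)
    (hp : ∀ n, p n ≤ ENNReal.ofReal K * (a n + b n))
    (ha : (c : EReal) ≤ Filter.atTop.liminf (fun n => expRate n (a n)))
    (hb : (c : EReal) ≤ Filter.atTop.liminf (fun n => expRate n (b n))) :
    (c : EReal) ≤ Filter.atTop.liminf (fun n => expRate n (p n)) := by
  rw [le_liminf_expRate_iff] at *
  intro c' hc'
  obtain ⟨d, hd1, hd2⟩ := exists_between hc'
  have ht : Tendsto (fun n : ℕ => Real.exp ((n : ℝ) * (d - c'))) atTop atTop :=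
    Real.tendsto_exp_atTop.comp
      (tendsto_natCast_atTop_atTop.atTop_mul_const (by linarith))
  filter_upwards [ha d hd2, hb d hd2, ht.eventually_ge_atTop (2 * K)] with n h1 h2 h3
  refine (hp n).trans ?_
  calc ENNReal.ofReal K * (a n + b n)
      ≤ ENNReal.ofReal K * (ENNReal.ofReal (Real.exp (-(n * d)))
          + ENNReal.ofReal (Real.exp (-(n * d)))) := by gcongr
    _ = ENNReal.ofReal (K * (Real.exp (-(n * d)) + Real.exp (-(n * d)))) := by
        rw [ENNReal.ofReal_mul hK, ENNReal.ofReal_add (Real.exp_pos _).le (Real.exp_pos _).le]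
    _ ≤ _ := by
        apply ENNReal.ofReal_le_ofReal
        have : Real.exp (-(n * c')) = Real.exp (n * (d - c')) * Real.exp (-(n * d)) := by
          rw [← Real.exp_add]; ring_nf
        rw [this]
        nlinarith [Real.exp_pos (-(n * d))]

section
variable {Ω : ℕ → Type*} [∀ n, MeasurableSpace (Ω n)]

lemma le_smul_left' (x : ℝ≥0∞) (y : ℝ≥0∞) (α β : ℝ) (hα : 0 < α) :
    x ≤ ENNReal.ofReal α⁻¹ *
      ((ENNReal.ofReal α * x + ENNReal.ofReal β * y) +
       (ENNReal.ofReal α * x + ENNReal.ofReal β * y)) := by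
  calc x = ENNReal.ofReal α⁻¹ * (ENNReal.ofReal α * x) := by
        rw [← mul_assoc, ← ENNReal.ofReal_mul (inv_pos.mpr hα).le, inv_mul_cancel₀ hα.ne']
        simp
    _ ≤ _ := by
        gcongr
        exact le_add_right le_self_add

lemma rAchievable_of_mix (P₁ P₂ Q₁ Q₂ : ∀ n, Measure (Ω n))
    (α₁ α₂ β₁ β₂ : ℝ) (hα₁ : 0 < α₁) (hβ₁ : 0 < β₁) (r E : ℝ)
    (h : rAchievable (fun n => ENNReal.ofReal α₁ • P₁ n + ENNReal.ofReal α₂ • P₂ n)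
       (fun n => ENNReal.ofReal β₁ • Q₁ n + ENNReal.ofReal β₂ • Q₂ n) r E) :
    rAchievable P₁ Q₁ r E := by
  obtain ⟨A, hA, h1, h2⟩ := h
  refine ⟨A, hA, rate_combine _ _ _ α₁⁻¹ (inv_pos.mpr hα₁).le r (fun n => ?_) h1 h1,
    rate_combine _ _ _ β₁⁻¹ (inv_pos.mpr hβ₁).le E (fun n => ?_) h2 h2⟩
  · simpa using le_smul_left' (P₁ n (A n)ᶜ) (P₂ n (A n)ᶜ) α₁ α₂ hα₁
  · simpa using le_smul_left' (Q₁ n (A n)) (Q₂ n (A n)) β₁ β₂ hβ₁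

lemma Be_mix_le (P₁ P₂ Q₁ Q₂ : ∀ n, Measure (Ω n))
    (α₁ α₂ β₁ β₂ : ℝ) (hα₁ : 0 < α₁) (hβ₁ : 0 < β₁) (r : ℝ) :
    Be (fun n => ENNReal.ofReal α₁ • P₁ n + ENNReal.ofReal α₂ • P₂ n)
       (fun n => ENNReal.ofReal β₁ • Q₁ n + ENNReal.ofReal β₂ • Q₂ n) r ≤ Be P₁ Q₁ r := by
  apply sSup_le_sSup
  rintro x ⟨E, hE, rfl⟩
  exact ⟨E, rAchievable_of_mix P₁ P₂ Q₁ Q₂ α₁ α₂ β₁ β₂ hα₁ hβ₁ r E hE, rfl⟩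

lemma rAchievable.anti {P Q : ∀ n, Measure (Ω n)} {r E E' : ℝ}
    (h : rAchievable P Q r E) (hE : E' ≤ E) : rAchievable P Q r E' := by
  obtain ⟨A, hA, h1, h2⟩ := h
  exact ⟨A, hA, h1, le_trans (by exact_mod_cast hE) h2⟩

lemma exists_of_lt_Be {P Q : ∀ n, Measure (Ω n)} {r : ℝ} {x : EReal} (h : x < Be P Q r) :
    ∃ E : ℝ, rAchievable P Q r E ∧ x < E := by
  obtain ⟨y, ⟨E, hE, rfl⟩, hy⟩ := lt_sSup_iff.1 h
  exact ⟨E, hE, hy⟩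

lemma mix_le (α₁ α₂ : ℝ) (h1 : α₁ ≤ 1) (h2 : α₂ ≤ 1) (x y : ℝ≥0∞) :
    ENNReal.ofReal α₁ * x + ENNReal.ofReal α₂ * y ≤ ENNReal.ofReal 1 * (x + y) := by
  rw [mul_add]
  gcongr

lemma rAchievable_mix (P₁ P₂ Q₁ Q₂ : ∀ n, Measure (Ω n))
    (α₁ α₂ β₁ β₂ : ℝ) (hα₁ : α₁ ≤ 1) (hα₂ : α₂ ≤ 1) (hβ₁ : β₁ ≤ 1) (hβ₂ : β₂ ≤ 1) (r E : ℝ)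
    (h11 : rAchievable P₁ Q₁ r E) (h12 : rAchievable P₁ Q₂ r E)
    (h21 : rAchievable P₂ Q₁ r E) (h22 : rAchievable P₂ Q₂ r E) :
    rAchievable (fun n => ENNReal.ofReal α₁ • P₁ n + ENNReal.ofReal α₂ • P₂ n)
       (fun n => ENNReal.ofReal β₁ • Q₁ n + ENNReal.ofReal β₂ • Q₂ n) r E := by
  obtain ⟨A, hA, a1, a2⟩ := h11
  obtain ⟨B, hB, b1, b2⟩ := h12
  obtain ⟨C, hC, c1, c2⟩ := h21
  obtain ⟨D, hD, d1, d2⟩ := h22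
  refine ⟨fun n => (A n ∩ B n) ∪ (C n ∩ D n),
    fun n => ((hA n).inter (hB n)).union ((hC n).inter (hD n)), ?_, ?_⟩
  · refine rate_combine _ (fun n => P₁ n ((A n ∩ B n) ∪ (C n ∩ D n))ᶜ)
      (fun n => P₂ n ((A n ∩ B n) ∪ (C n ∩ D n))ᶜ) 1 zero_le_one r (fun n => ?_) ?_ ?_
    · simpa only [Measure.add_apply, Measure.smul_apply, smul_eq_mul]
        using mix_le α₁ α₂ hα₁ hα₂ _ _
    · refine rate_combine _ _ _ 1 zero_le_one r (fun n => ?_) a1 b1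
      rw [ENNReal.ofReal_one, one_mul]
      refine le_trans (measure_mono ?_) (measure_union_le _ _)
      intro x; simp only [Set.mem_compl_iff, Set.mem_union, Set.mem_inter_iff]; tauto
    · refine rate_combine _ _ _ 1 zero_le_one r (fun n => ?_) c1 d1
      rw [ENNReal.ofReal_one, one_mul]
      refine le_trans (measure_mono ?_) (measure_union_le _ _)
      intro x; simp only [Set.mem_compl_iff, Set.mem_union, Set.mem_inter_iff]; tauto
  · refine rate_combine _ (fun n => Q₁ n ((A n ∩ B n) ∪ (C n ∩ D n)))
      (fun n => Q₂ n ((A n ∩ B n) ∪ (C n ∩ D n))) 1 zero_le_one E (fun n => ?_) ?_ ?_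
    · simpa only [Measure.add_apply, Measure.smul_apply, smul_eq_mul]
        using mix_le β₁ β₂ hβ₁ hβ₂ _ _
    · refine rate_combine _ _ _ 1 zero_le_one E (fun n => ?_) a2 c2
      rw [ENNReal.ofReal_one, one_mul]
      refine le_trans (measure_mono ?_) (measure_union_le _ _)
      intro x; simp only [Set.mem_union, Set.mem_inter_iff]; tauto
    · refine rate_combine _ _ _ 1 zero_le_one E (fun n => ?_) b2 d2
      rw [ENNReal.ofReal_one, one_mul]
      refine le_trans (measure_mono ?_) (measure_union_le _ _)
      intro x; simp only [Set.mem_union, Set.mem_inter_iff]; tauto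

end

/-- Mixed-source formula (Remark 3.1, eq. (3.28)): for mixed null hypothesis
`P_n = α₁ P_{1,n} + α₂ P_{2,n}` and mixed alternative `Q_n = β₁ Q_{1,n} + β₂ Q_{2,n}`,
`B_e(r | P‖Q) = min_{i,j} B_e(r | P_i‖Q_j)`. -/
theorem han_mixed_source_formula {Ω : ℕ → Type*} [∀ n, MeasurableSpace (Ω n)]
    (P₁ P₂ Q₁ Q₂ : ∀ n, Measure (Ω n))
    [∀ n, IsProbabilityMeasure (P₁ n)] [∀ n, IsProbabilityMeasure (P₂ n)]
    [∀ n, IsProbabilityMeasure (Q₁ n)] [∀ n, IsProbabilityMeasure (Q₂ n)]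
    (α₁ α₂ β₁ β₂ : ℝ) (hα₁ : 0 < α₁) (hα₂ : 0 < α₂) (hα : α₁ + α₂ = 1)
    (hβ₁ : 0 < β₁) (hβ₂ : 0 < β₂) (hβ : β₁ + β₂ = 1) (r : ℝ) (hr : 0 < r) :
    Be (fun n => ENNReal.ofReal α₁ • P₁ n + ENNReal.ofReal α₂ • P₂ n)
       (fun n => ENNReal.ofReal β₁ • Q₁ n + ENNReal.ofReal β₂ • Q₂ n) r
      = min (min (Be P₁ Q₁ r) (Be P₁ Q₂ r)) (min (Be P₂ Q₁ r) (Be P₂ Q₂ r)) := by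
  apply le_antisymm
  · refine le_min (le_min ?_ ?_) (le_min ?_ ?_)
    · exact Be_mix_le P₁ P₂ Q₁ Q₂ α₁ α₂ β₁ β₂ hα₁ hβ₁ r
    · have h := Be_mix_le P₁ P₂ Q₂ Q₁ α₁ α₂ β₂ β₁ hα₁ hβ₂ r
      simpa only [add_comm (ENNReal.ofReal β₂ • Q₂ _)] using h
    · have h := Be_mix_le P₂ P₁ Q₁ Q₂ α₂ α₁ β₁ β₂ hα₂ hβ₁ r
      simpa only [add_comm (ENNReal.ofReal α₂ • P₂ _)] using h
    · have h := Be_mix_le P₂ P₁ Q₂ Q₁ α₂ α₁ β₂ β₁ hα₂ hβ₂ r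
      simpa only [add_comm (ENNReal.ofReal α₂ • P₂ _), add_comm (ENNReal.ofReal β₂ • Q₂ _)] using h
  · refine le_of_forall_lt fun x hx => ?_
    simp only [lt_min_iff] at hx
    obtain ⟨⟨h11, h12⟩, h21, h22⟩ := hx
    obtain ⟨E1, e1, l1⟩ := exists_of_lt_Be h11
    obtain ⟨E2, e2, l2⟩ := exists_of_lt_Be h12
    obtain ⟨E3, e3, l3⟩ := exists_of_lt_Be h21
    obtain ⟨E4, e4, l4⟩ := exists_of_lt_Be h22
    have key : ∃ E : ℝ, x < (E : EReal) ∧ E ≤ E1 ∧ E ≤ E2 ∧ E ≤ E3 ∧ E ≤ E4 := by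
      refine ⟨min (min E1 E2) (min E3 E4), ?_, by simp, by simp, by simp, by simp⟩
      rcases min_choice (min E1 E2) (min E3 E4) with h | h <;> rw [h]
      · rcases min_choice E1 E2 with h | h <;> rw [h] <;> assumption
      · rcases min_choice E3 E4 with h | h <;> rw [h] <;> assumption
    obtain ⟨E, hxE, i1, i2, i3, i4⟩ := key
    refine lt_of_lt_of_le hxE (le_sSup ⟨E, ?_, rfl⟩)
    exact rAchievable_mix P₁ P₂ Q₁ Q₂ α₁ α₂ β₁ β₂ (by linarith) (by linarith) (by linarith)
      (by linarith) r E (e1.anti i1) (e2.anti i2) (e3.anti i3) (e4.anti i4)
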